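/- Let α > 0, C₁ > 0, and let u : ℝ → ℝ be continuous and 2π-periodic with ω₁(δ,u) ≥ C₁ δ^{2α+3} for all δ ∈ (0,1), where ω₁(δ,u) = inf_{x,c₁,c₂∈ℝ} ∫_{x−δ}^{x+δ} |ψ(y) − c₁ − c₂ y|² dy for ψ with ψ' = u. Let ν > 0 and let k be a nonzero integer with ν|k|^{−1} ≤ 1/2. Then for every twice continuously differentiable 2π-periodic f : ℝ → ℂ and every λ ∈ ℝ, ‖−ν f'' + i k u f − i λ f‖_{L²(0,2π)} ≥ ε · ν^{α/(α+2)} |k|^{2/(α+2)} · ‖f‖_{L²(0,2π)}, where ε = (φ^{−1}(C₁))² and φ^{−1} is the inverse of the bijection φ : [0,π/2) → [0,∞), φ(x) = 36 x tan x. -/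

import Mathlib

/-- The `L²(0, 2π)` norm of a (`2π`-periodic) function `f : ℝ → ℂ`. -/
noncomputable def l2norm (f : ℝ → ℂ) : ℝ :=
  Real.sqrt (∫ y in (0 : ℝ)..(2 * Real.pi), ‖f y‖ ^ 2)

/-- `ω₁(δ, u) = inf_{x, c₁, c₂} ∫_{x-δ}^{x+δ} |ψ(y) - c₁ - c₂y|² dy`, `ψ' = u`. -/
noncomputable def omega1 (δ : ℝ) (ψ : ℝ → ℝ) : ℝ :=
  sInf {r : ℝ | ∃ x c₁ c₂ : ℝ, r = ∫ y in (x - δ)..(x + δ), (ψ y - c₁ - c₂ * y) ^ 2}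

/-- The inverse of the increasing bijection `φ : [0, π/2) → [0, ∞)`,
`φ(x) = 36 x tan x`. -/
noncomputable def phiInv (r : ℝ) : ℝ :=
  sSup {x : ℝ | x ∈ Set.Ico 0 (Real.pi / 2) ∧ 36 * x * Real.tan x ≤ r}

theorem hasDerivAt_norm_of_ne_zero {f : ℝ → ℂ} {f' : ℂ} {t : ℝ} (hf : HasDerivAt f f' t)
    (h0 : f t ≠ 0) : HasDerivAt (fun s => ‖f s‖) (‖f t‖ * (f' / f t).re) t := by
  have h1 := hf.norm_sq
  have h2 := h1.sqrt (by positivity)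
  simp only [Real.sqrt_sq (norm_nonneg _)] at h2
  refine HasDerivAt.congr_deriv h2 ?_
  have hn : ‖f t‖ ≠ 0 := by simpa using h0
  have e : inner ℝ (f t) f' = (f' / f t).re * ‖f t‖ ^ 2 := by
    rw [Complex.inner, ← Complex.normSq_eq_norm_sq, Complex.div_re]
    have : Complex.normSq (f t) ≠ 0 := by simpa using h0
    field_simp
    simp [Complex.mul_re]
  rw [e]
  field_simp

theorem hasDerivAt_logDeriv {f f₁ : ℝ → ℂ} {f₂ : ℂ} {t : ℝ} (hf : HasDerivAt f (f₁ t) t)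
    (hf₁ : HasDerivAt f₁ f₂ t) (h0 : f t ≠ 0) :
    HasDerivAt (fun s => f₁ s / f s) (f₂ / f t - (f₁ t / f t) ^ 2) t := by
  refine HasDerivAt.congr_deriv (hf₁.div hf h0) ?_
  field_simp

theorem HasDerivAt.complex_re {f : ℝ → ℂ} {f' : ℂ} {t : ℝ} (hf : HasDerivAt f f' t) :
    HasDerivAt (fun s => (f s).re) f'.re t :=
  (Complex.reCLM.hasFDerivAt.comp_hasDerivAt t hf)

theorem HasDerivAt.complex_im {f : ℝ → ℂ} {f' : ℂ} {t : ℝ} (hf : HasDerivAt f f' t) :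
    HasDerivAt (fun s => (f s).im) f'.im t :=
  (Complex.imCLM.hasFDerivAt.comp_hasDerivAt t hf)

section Comparison

variable {f f₁ f₂ : ℝ → ℂ} {μ θ t₁ t₂ : ℝ}

theorem norm_mul_cos_le_of_forall_ne_zero (hf : ∀ t, HasDerivAt f (f₁ t) t)
    (hf₁ : ∀ t, HasDerivAt f₁ (f₂ t) t)
    (hre : ∀ t, f t ≠ 0 → -μ ^ 2 ≤ (f₂ t / f t).re) (hμ : 0 < μ) (h12 : t₁ ≤ t₂)
    (hne : ∀ t ∈ Set.Icc t₁ t₂, f t ≠ 0) (hθ : θ < Real.pi / 2)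
    (h2 : μ * (t₂ - t₁) - θ < Real.pi / 2) (hθ' : -(Real.pi / 2) < θ)
    (hp : (f₁ t₁ / f t₁).re = μ * Real.tan θ) :
    ‖f t₁‖ * Real.cos (μ * (t₂ - t₁) - θ) ≤ ‖f t₂‖ * Real.cos θ := by
  set φ : ℝ → ℝ := fun t => Real.cos (μ * (t - t₁) - θ) with hφ
  set σ : ℝ → ℝ := fun t => μ * Real.sin (μ * (t - t₁) - θ) with hσ
  have hφd : ∀ t, HasDerivAt φ (-σ t) t := fun t => by
    have h : HasDerivAt (fun t => μ * (t - t₁) - θ) μ t := by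
      simpa using (((hasDerivAt_id t).sub_const t₁).const_mul μ).sub_const θ
    refine HasDerivAt.congr_deriv h.cos ?_; simp [hσ]; ring
  have hσd : ∀ t, HasDerivAt σ (μ ^ 2 * φ t) t := fun t => by
    have h : HasDerivAt (fun t => μ * (t - t₁) - θ) μ t := by
      simpa using (((hasDerivAt_id t).sub_const t₁).const_mul μ).sub_const θ
    refine HasDerivAt.congr_deriv (h.sin.const_mul μ) ?_; simp [hφ]; ring
  have hφpos : ∀ t ∈ Set.Icc t₁ t₂, 0 < φ t := fun t ht => by
    apply Real.cos_pos_of_mem_Ioo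
    have := mul_le_mul_of_nonneg_left (sub_le_sub_right ht.2 t₁) hμ.le
    have := mul_nonneg hμ.le (sub_nonneg.2 ht.1)
    constructor <;> linarith
  set r : ℝ → ℝ := fun t => ‖f t‖ with hr
  set p : ℝ → ℝ := fun t => (f₁ t / f t).re with hpdef
  have hrd : ∀ t ∈ Set.Icc t₁ t₂, HasDerivAt r (r t * p t) t := fun t ht =>
    hasDerivAt_norm_of_ne_zero (hf t) (hne t ht)
  have hpd : ∀ t ∈ Set.Icc t₁ t₂,
      HasDerivAt p ((f₂ t / f t).re - p t ^ 2 + (f₁ t / f t).im ^ 2) t := fun t ht => by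
    refine HasDerivAt.congr_deriv ((hasDerivAt_logDeriv (hf t) (hf₁ t) (hne t ht)).complex_re) ?_
    simp only [Complex.sub_re, pow_two, Complex.mul_re, hpdef]; ring
  set X : ℝ → ℝ := fun t => r t * (p t * φ t + σ t) with hX
  have hXd : ∀ t ∈ Set.Icc t₁ t₂, HasDerivAt X
      (r t * φ t * ((f₂ t / f t).re + μ ^ 2 + (f₁ t / f t).im ^ 2)) t := fun t ht => by
    refine HasDerivAt.congr_deriv ((hrd t ht).mul (((hpd t ht).mul (hφd t)).add (hσd t))) ?_
    ring
  have hXmono : MonotoneOn X (Set.Icc t₁ t₂) := by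
    apply monotoneOn_of_deriv_nonneg (convex_Icc _ _)
    · exact fun t ht => (hXd t ht).continuousAt.continuousWithinAt
    · exact fun t ht => (hXd t (interior_subset ht)).differentiableAt.differentiableWithinAt
    · intro t ht
      have ht := interior_subset ht
      rw [(hXd t ht).deriv]
      have := hre t (hne t ht)
      have := hφpos t ht
      have : 0 ≤ (f₂ t / f t).re + μ ^ 2 + (f₁ t / f t).im ^ 2 := by nlinarith [sq_nonneg (f₁ t / f t).im]
      have : 0 ≤ r t := norm_nonneg _
      positivity
  have hX1 : X t₁ = 0 := by
    have hc : Real.cos θ ≠ 0 := (Real.cos_pos_of_mem_Ioo ⟨hθ', hθ⟩).ne'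
    simp only [hX, hpdef, hφ, hσ, hp, sub_self, mul_zero, zero_sub, Real.cos_neg, Real.sin_neg,
      Real.tan_eq_sin_div_cos]
    field_simp
    ring
  have hXnn : ∀ t ∈ Set.Icc t₁ t₂, 0 ≤ X t := fun t ht =>
    hX1 ▸ hXmono (Set.left_mem_Icc.2 h12) ht ht.1
  have hYd : ∀ t ∈ Set.Icc t₁ t₂, HasDerivAt (fun t => r t / φ t) (X t / φ t ^ 2) t :=
    fun t ht => by
      refine HasDerivAt.congr_deriv ((hrd t ht).div (hφd t) (hφpos t ht).ne') ?_
      simp only [hX]; ring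
  have hYmono : MonotoneOn (fun t => r t / φ t) (Set.Icc t₁ t₂) := by
    apply monotoneOn_of_deriv_nonneg (convex_Icc _ _)
    · exact fun t ht => (hYd t ht).continuousAt.continuousWithinAt
    · exact fun t ht => (hYd t (interior_subset ht)).differentiableAt.differentiableWithinAt
    · intro t ht
      have ht := interior_subset ht
      rw [(hYd t ht).deriv]
      exact div_nonneg (hXnn t ht) (sq_nonneg _)
  have := hYmono (Set.left_mem_Icc.2 h12) (Set.right_mem_Icc.2 h12) h12
  simp only at this
  rw [div_le_div_iff₀ (hφpos _ (Set.left_mem_Icc.2 h12)) (hφpos _ (Set.right_mem_Icc.2 h12))] at this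
  simpa [hφ] using this

theorem norm_mul_cos_le (hf : ∀ t, HasDerivAt f (f₁ t) t)
    (hf₁ : ∀ t, HasDerivAt f₁ (f₂ t) t)
    (hre : ∀ t, f t ≠ 0 → -μ ^ 2 ≤ (f₂ t / f t).re) (hμ : 0 < μ) (h12 : t₁ ≤ t₂)
    (hne : f t₁ ≠ 0) (hθ : θ < Real.pi / 2)
    (h2 : μ * (t₂ - t₁) - θ < Real.pi / 2) (hθ' : -(Real.pi / 2) < θ)
    (hp : (f₁ t₁ / f t₁).re = μ * Real.tan θ) :
    ‖f t₁‖ * Real.cos (μ * (t₂ - t₁) - θ) ≤ ‖f t₂‖ * Real.cos θ := by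
  apply norm_mul_cos_le_of_forall_ne_zero hf hf₁ hre hμ h12 _ hθ h2 hθ' hp
  by_contra! hcon
  obtain ⟨t, ht, hft⟩ := hcon
  have hfc : Continuous f := continuous_iff_continuousAt.2 fun t => (hf t).continuousAt
  have hcpt : IsCompact (Set.Icc t₁ t₂ ∩ {t | f t = 0}) :=
    isCompact_Icc.inter_right (isClosed_singleton.preimage hfc)
  obtain ⟨s, hs⟩ := hcpt.exists_isLeast ⟨t, ht, hft⟩
  obtain ⟨⟨hs12, hs0⟩, hsmin⟩ := hs
  have hs1 : t₁ < s := lt_of_le_of_ne hs12.1 (by rintro rfl; exact hne hs0)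
  have key : ∀ t ∈ Set.Ico t₁ s, ‖f t₁‖ * Real.cos (μ * (t - t₁) - θ) ≤ ‖f t‖ * Real.cos θ := by
    intro t ht
    have := mul_le_mul_of_nonneg_left (sub_le_sub_right (ht.2.le.trans hs12.2) t₁) hμ.le
    refine norm_mul_cos_le_of_forall_ne_zero hf hf₁ hre hμ ht.1 ?_ hθ (by linarith) hθ' hp
    intro τ hτ h0
    have := hsmin ⟨⟨hτ.1, hτ.2.trans (ht.2.le.trans hs12.2)⟩, h0⟩
    linarith [hτ.2, ht.2]
  have hlim : ‖f t₁‖ * Real.cos (μ * (s - t₁) - θ) ≤ ‖f s‖ * Real.cos θ := by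
    have hmem : s ∈ closure (Set.Ico t₁ s) := by
      rw [closure_Ico hs1.ne]; exact Set.right_mem_Icc.2 hs1.le
    exact le_on_closure key (by fun_prop) (by fun_prop) hmem
  have hs0 : f s = 0 := hs0
  rw [hs0, norm_zero, zero_mul] at hlim
  have h3 : 0 < Real.cos (μ * (s - t₁) - θ) := by
    apply Real.cos_pos_of_mem_Ioo
    have := mul_le_mul_of_nonneg_left (sub_le_sub_right hs12.2 t₁) hμ.le
    have := mul_nonneg hμ.le (sub_nonneg.2 hs12.1)
    constructor <;> linarith
  have : 0 < ‖f t₁‖ := by simpa using hne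
  nlinarith [mul_pos this h3]

/-- A one-sided energy bound at points where the modulus is nondecreasing. -/
theorem norm_sq_add_le_of_nonneg {M : ℝ} (hf : ∀ t, HasDerivAt f (f₁ t) t)
    (hf₁ : ∀ t, HasDerivAt f₁ (f₂ t) t)
    (hre : ∀ t, f t ≠ 0 → -μ ^ 2 ≤ (f₂ t / f t).re) (hμ : 0 < μ) (hM : ∀ t, ‖f t‖ ≤ M) {t : ℝ}
    (hne : f t ≠ 0) (hp : 0 ≤ (f₁ t / f t).re) :
    ‖f t‖ ^ 2 * (μ ^ 2 + (f₁ t / f t).re ^ 2) ≤ μ ^ 2 * M ^ 2 := by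
  set p := (f₁ t / f t).re
  have hθ := Real.arctan_lt_pi_div_two (p / μ)
  have hθ' := Real.neg_pi_div_two_lt_arctan (p / μ)
  have hθ0 : 0 ≤ Real.arctan (p / μ) := Real.arctan_nonneg.2 (by positivity)
  have h := norm_mul_cos_le (t₁ := t) (t₂ := t + Real.arctan (p / μ) / μ) hf hf₁ hre hμ
    (by have : 0 ≤ Real.arctan (p / μ) / μ := by positivity
        linarith) hne hθ
    (by rw [add_sub_cancel_left, mul_div_cancel₀ _ hμ.ne']; simp; positivity) hθ'
    (by rw [Real.tan_arctan]; field_simp; rfl)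
  rw [add_sub_cancel_left, mul_div_cancel₀ _ hμ.ne', sub_self, Real.cos_zero, mul_one] at h
  have hc : 0 ≤ Real.cos (Real.arctan (p / μ)) := (Real.cos_arctan_pos _).le
  have h1 : ‖f t‖ ≤ M * Real.cos (Real.arctan (p / μ)) :=
    h.trans (mul_le_mul_of_nonneg_right (hM _) hc)
  have h2 := pow_le_pow_left₀ (norm_nonneg _) h1 2
  rw [mul_pow, Real.cos_sq_arctan] at h2
  have e : μ ^ 2 + p ^ 2 = μ ^ 2 * (1 + (p / μ) ^ 2) := by field_simp
  have hpos : 0 < 1 + (p / μ) ^ 2 := by positivity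
  rw [e]
  calc ‖f t‖ ^ 2 * (μ ^ 2 * (1 + (p / μ) ^ 2))
      ≤ M ^ 2 * (1 / (1 + (p / μ) ^ 2)) * (μ ^ 2 * (1 + (p / μ) ^ 2)) := by gcongr
    _ = μ ^ 2 * M ^ 2 := by field_simp

theorem hasDerivAt_comp_neg' {E : Type*} [NormedAddCommGroup E] [NormedSpace ℝ E] {f f' : ℝ → E}
    (hf : ∀ t, HasDerivAt f (f' t) t) (t : ℝ) :
    HasDerivAt (fun s => f (-s)) (-f' (-t)) t := by
  exact HasDerivAt.congr_deriv ((hf (-t)).scomp t (hasDerivAt_neg t)) (by simp)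

theorem norm_sq_add_le {M : ℝ} (hf : ∀ t, HasDerivAt f (f₁ t) t)
    (hf₁ : ∀ t, HasDerivAt f₁ (f₂ t) t)
    (hre : ∀ t, f t ≠ 0 → -μ ^ 2 ≤ (f₂ t / f t).re) (hμ : 0 < μ) (hM : ∀ t, ‖f t‖ ≤ M) {t : ℝ}
    (hne : f t ≠ 0) :
    ‖f t‖ ^ 2 * (μ ^ 2 + (f₁ t / f t).re ^ 2) ≤ μ ^ 2 * M ^ 2 := by
  rcases le_total 0 (f₁ t / f t).re with hp | hp
  · exact norm_sq_add_le_of_nonneg hf hf₁ hre hμ hM hne hp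
  · have := norm_sq_add_le_of_nonneg (f := fun s => f (-s)) (f₁ := fun s => -f₁ (-s))
      (f₂ := fun s => f₂ (-s)) (hasDerivAt_comp_neg' hf)
      (fun t => HasDerivAt.congr_deriv (hasDerivAt_comp_neg' hf₁ t).neg (neg_neg _))
      (fun t ht => hre (-t) ht) hμ (fun t => hM (-t)) (t := -t) (by simpa using hne)
      (by simp only [neg_neg, neg_div, Complex.neg_re]; linarith)
    simpa only [neg_neg, neg_div, Complex.neg_re, neg_sq] using this

end Comparison

section Window

variable {f f₁ f₂ : ℝ → ℂ} {V W : ℝ → ℝ} {μ δ : ℝ}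

theorem re_div_ge_of_norm_le {z₀ z₂ : ℂ} {w c : ℝ} (h0 : z₀ ≠ 0)
    (h : ‖-z₂ + Complex.I * w * z₀‖ ≤ c * ‖z₀‖) :
    -c ≤ (z₂ / z₀).re ∧ |w - (z₂ / z₀).im| ≤ c := by
  have hpos : 0 < ‖z₀‖ := norm_pos_iff.2 h0
  have h1 : ‖-(z₂ / z₀) + Complex.I * w‖ ≤ c := by
    have e : -(z₂ / z₀) + Complex.I * w = (-z₂ + Complex.I * w * z₀) / z₀ := by field_simp
    rw [e, norm_div, div_le_iff₀ hpos]
    exact h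
  have hre := (Complex.abs_re_le_norm _).trans h1
  have him := (Complex.abs_im_le_norm _).trans h1
  simp only [Complex.add_re, Complex.neg_re, Complex.mul_re, Complex.I_re, Complex.ofReal_re,
    zero_mul, Complex.I_im, Complex.ofReal_im, mul_zero, sub_self, add_zero, abs_neg] at hre
  simp only [Complex.add_im, Complex.neg_im, Complex.mul_im, Complex.I_re, Complex.ofReal_re,
    zero_mul, Complex.I_im, Complex.ofReal_im, one_mul, zero_add] at him
  exact ⟨(abs_le.1 hre).1, by rwa [neg_add_eq_sub] at him⟩

theorem integral_sq_sub_le_of_isMax (hf : ∀ t, HasDerivAt f (f₁ t) t)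
    (hf₁ : ∀ t, HasDerivAt f₁ (f₂ t) t) (hV : ∀ t, HasDerivAt V (W t) t)
    (hg : ∀ t, ‖-f₂ t + Complex.I * W t * f t‖ ≤ μ ^ 2 * ‖f t‖)
    (hμ : 0 < μ) (hδ : 0 < δ) (hμδ : μ * δ < Real.pi / 2)
    (h0 : f 0 ≠ 0) (hmax : ∀ t, ‖f t‖ ≤ ‖f 0‖) :
    ∫ t in (0 : ℝ)..δ, (V t - (V 0 - (f₁ 0 / f 0).im)) ^ 2 ≤ 18 * (μ * Real.tan (μ * δ)) := by
  have hre : ∀ t, f t ≠ 0 → -μ ^ 2 ≤ (f₂ t / f t).re := fun t ht =>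
    (re_div_ge_of_norm_le ht (hg t)).1
  have hpos0 : 0 < ‖f 0‖ := norm_pos_iff.2 h0
  have hp0 : (f₁ 0 / f 0).re = 0 := by
    have h1 : IsLocalMax (fun s => ‖f s‖) 0 := Filter.Eventually.of_forall hmax
    have := h1.hasDerivAt_eq_zero (hasDerivAt_norm_of_ne_zero (hf 0) h0)
    exact (mul_eq_zero.1 this).resolve_left hpos0.ne'
  have hang : ∀ t ∈ Set.Icc 0 δ, 0 ≤ μ * t ∧ μ * t < Real.pi / 2 := fun t ht =>
    ⟨mul_nonneg hμ.le ht.1, (mul_le_mul_of_nonneg_left ht.2 hμ.le).trans_lt hμδ⟩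
  have hcos : ∀ t ∈ Set.Icc 0 δ, 0 < Real.cos (μ * t) := fun t ht =>
    Real.cos_pos_of_mem_Ioo ⟨by linarith [(hang t ht).1, Real.pi_pos], (hang t ht).2⟩
  have hlow : ∀ t ∈ Set.Icc 0 δ, ‖f 0‖ * Real.cos (μ * t) ≤ ‖f t‖ := fun t ht => by
    have := norm_mul_cos_le (θ := 0) (t₂ := t) hf hf₁ hre hμ ht.1 h0 (by positivity)
      (by simpa using (hang t ht).2) (by linarith [Real.pi_pos]) (by simpa using hp0)
    simpa using this
  have hne : ∀ t ∈ Set.Icc 0 δ, f t ≠ 0 := fun t ht =>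
    norm_pos_iff.1 ((mul_pos hpos0 (hcos t ht)).trans_le (hlow t ht))
  set T : ℝ → ℝ := fun t => μ * Real.tan (μ * t) with hT
  set p : ℝ → ℝ := fun t => (f₁ t / f t).re with hp
  set q : ℝ → ℝ := fun t => (f₁ t / f t).im with hq
  have hTd : ∀ t ∈ Set.Icc 0 δ, HasDerivAt T (μ ^ 2 + T t ^ 2) t := fun t ht => by
    have h : HasDerivAt (fun t => μ * t) μ t := by simpa using (hasDerivAt_id t).const_mul μ
    refine HasDerivAt.congr_deriv
      (((Real.hasDerivAt_tan (hcos t ht).ne').comp t h).const_mul μ) ?_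
    have := Real.inv_one_add_tan_sq (hcos t ht).ne'
    rw [one_div, ← this, inv_inv]
    simp only [hT]; ring
  have hTnn : ∀ t ∈ Set.Icc 0 δ, 0 ≤ T t := fun t ht =>
    mul_nonneg hμ.le (Real.tan_nonneg_of_nonneg_of_le_pi_div_two (hang t ht).1 (hang t ht).2.le)
  have hpT : ∀ t ∈ Set.Icc 0 δ, p t ^ 2 ≤ T t ^ 2 := fun t ht => by
    have h1 := norm_sq_add_le hf hf₁ hre hμ hmax (hne t ht)
    have h2 := pow_le_pow_left₀ (mul_pos hpos0 (hcos t ht)).le (hlow t ht) 2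
    have h3 : (‖f 0‖ * Real.cos (μ * t)) ^ 2 * (μ ^ 2 + p t ^ 2) ≤ μ ^ 2 * ‖f 0‖ ^ 2 :=
      (mul_le_mul_of_nonneg_right h2 (by positivity)).trans h1
    have hc2 : 0 < Real.cos (μ * t) ^ 2 := pow_pos (hcos t ht) 2
    have h4 : Real.cos (μ * t) ^ 2 * (μ ^ 2 + p t ^ 2) ≤ μ ^ 2 := by
      have : 0 < ‖f 0‖ ^ 2 := by positivity
      nlinarith
    have h5 : T t ^ 2 * Real.cos (μ * t) ^ 2 = μ ^ 2 * (1 - Real.cos (μ * t) ^ 2) := by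
      simp only [hT, mul_pow, Real.tan_eq_sin_div_cos, div_pow]
      rw [← Real.sin_sq]
      have := (hcos t ht).ne'
      field_simp
    nlinarith
  have hpabs : ∀ t ∈ Set.Icc 0 δ, |p t| ≤ T t := fun t ht =>
    abs_le_of_sq_le_sq (hpT t ht) (hTnn t ht)
  have hpd : ∀ t ∈ Set.Icc 0 δ, HasDerivAt p ((f₂ t / f t).re - p t ^ 2 + q t ^ 2) t :=
    fun t ht => by
      refine HasDerivAt.congr_deriv
        (hasDerivAt_logDeriv (hf t) (hf₁ t) (hne t ht)).complex_re ?_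
      simp only [Complex.sub_re, pow_two, Complex.mul_re, hp, hq]; ring
  have hqd : ∀ t ∈ Set.Icc 0 δ, HasDerivAt q ((f₂ t / f t).im - 2 * p t * q t) t :=
    fun t ht => by
      refine HasDerivAt.congr_deriv
        (hasDerivAt_logDeriv (hf t) (hf₁ t) (hne t ht)).complex_im ?_
      simp only [Complex.sub_im, pow_two, Complex.mul_im, hp, hq]; ring
  set R : ℝ → ℝ := fun t => V t - (V 0 - q 0) - q t with hR
  have hRd : ∀ t ∈ Set.Icc 0 δ, HasDerivAt R (W t - (f₂ t / f t).im + 2 * p t * q t) t :=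
    fun t ht => HasDerivAt.congr_deriv (((hV t).sub_const _).sub (hqd t ht)) (by ring)
  have hmem0 : (0 : ℝ) ∈ Set.Icc 0 δ := Set.left_mem_Icc.2 hδ.le
  have hs2 : Real.sqrt 2 ^ 2 = 2 := Real.sq_sqrt (by norm_num)
  have hs2' : 1 ≤ Real.sqrt 2 := Real.one_le_sqrt.2 (by norm_num)
  have hRS : ∀ t ∈ Set.Icc 0 δ, |W t - (f₂ t / f t).im + 2 * p t * q t| * Real.sqrt 2 ≤
      3 * (μ ^ 2 + T t ^ 2) + ((f₂ t / f t).re - p t ^ 2 + q t ^ 2) := fun t ht => by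
    obtain ⟨h1, h2⟩ := re_div_ge_of_norm_le (hne t ht) (hg t)
    have h3 : |2 * p t * q t| * Real.sqrt 2 ≤ 2 * p t ^ 2 + q t ^ 2 := by
      rw [abs_mul, abs_mul, abs_two]
      nlinarith [sq_nonneg (Real.sqrt 2 * |p t| - |q t|), sq_abs (p t), sq_abs (q t)]
    have h4 := hpT t ht
    have h5 := abs_add_le (W t - (f₂ t / f t).im) (2 * p t * q t)
    have h6 : |W t - (f₂ t / f t).im| * Real.sqrt 2 ≤ 2 * μ ^ 2 := by
      have : Real.sqrt 2 ≤ 2 := by nlinarith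
      rw [mul_comm 2]
      exact mul_le_mul h2 this (by positivity) (by positivity)
    nlinarith
  have hmono : ∀ ε : ℝ, |ε| = 1 → MonotoneOn (fun t => 3 * T t + p t - ε * Real.sqrt 2 * R t)
      (Set.Icc 0 δ) := fun ε hε => by
    have hd : ∀ t ∈ Set.Icc 0 δ, HasDerivAt (fun t => 3 * T t + p t - ε * Real.sqrt 2 * R t)
        (3 * (μ ^ 2 + T t ^ 2) + ((f₂ t / f t).re - p t ^ 2 + q t ^ 2) -
          ε * Real.sqrt 2 * (W t - (f₂ t / f t).im + 2 * p t * q t)) t := fun t ht =>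
      (((hTd t ht).const_mul 3).add (hpd t ht)).sub ((hRd t ht).const_mul _)
    apply monotoneOn_of_deriv_nonneg (convex_Icc _ _)
    · exact fun t ht => (hd t ht).continuousAt.continuousWithinAt
    · exact fun t ht => (hd t (interior_subset ht)).differentiableAt.differentiableWithinAt
    · intro t ht
      have ht := interior_subset ht
      rw [(hd t ht).deriv]
      have h1 := hRS t ht
      have h2 := le_abs_self (ε * Real.sqrt 2 * (W t - (f₂ t / f t).im + 2 * p t * q t))
      rw [abs_mul, abs_mul, hε, abs_of_nonneg (Real.sqrt_nonneg 2)] at h2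
      linarith
  have hR0 : R 0 = 0 := by simp [hR]
  have hT0 : T 0 = 0 := by simp [hT]
  have hRT : ∀ t ∈ Set.Icc 0 δ, R t ^ 2 ≤ 8 * T t ^ 2 := fun t ht => by
    have h1 := hmono 1 (by simp) hmem0 ht ht.1
    have h2 := hmono (-1) (by simp) hmem0 ht ht.1
    have hp0 : p 0 = 0 := hp0
    simp only [hR0, hT0, hp0] at h1 h2
    have h3 := (abs_le.1 (hpabs t ht)).2
    have h4 : |Real.sqrt 2 * R t| ≤ 4 * T t := abs_le.2 ⟨by linarith, by linarith⟩
    have h5 := sq_le_sq' (abs_le.1 h4).1 (abs_le.1 h4).2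
    rw [mul_pow, hs2] at h5
    linarith
  have hVc : Continuous V := continuous_iff_continuousAt.2 fun t => (hV t).continuousAt
  have hΦd : ∀ t ∈ Set.Icc 0 δ, HasDerivAt (fun t => 3 * p t + 15 * T t)
      (3 * ((f₂ t / f t).re - p t ^ 2 + q t ^ 2) + 15 * (μ ^ 2 + T t ^ 2)) t := fun t ht =>
    ((hpd t ht).const_mul 3).add ((hTd t ht).const_mul 15)
  have hfin := intervalIntegral.integral_le_sub_of_hasDeriv_right_of_le
    (φ := fun t => (V t - (V 0 - q 0)) ^ 2) hδ.le
    (fun t ht => (hΦd t ht).continuousAt.continuousWithinAt)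
    (fun t ht => (hΦd t (Set.Ioo_subset_Icc_self ht)).hasDerivWithinAt)
    (Continuous.integrableOn_Icc (by fun_prop))
    (fun t ht => by
      have ht := Set.Ioo_subset_Icc_self ht
      have h1 := hre t (hne t ht)
      have h2 := hpT t ht
      have h3 := hRT t ht
      have e : V t - (V 0 - q 0) = q t + R t := by simp [hR]
      rw [e]
      nlinarith [sq_nonneg (2 * q t - R t)])
  refine hfin.trans ?_
  have h3 := (abs_le.1 (hpabs δ (Set.right_mem_Icc.2 hδ.le))).2
  have hp0 : p 0 = 0 := hp0
  simp only [hp0, hT0]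
  have : T δ = μ * Real.tan (μ * δ) := rfl
  linarith

theorem exists_integral_sq_sub_le (hf : ∀ t, HasDerivAt f (f₁ t) t)
    (hf₁ : ∀ t, HasDerivAt f₁ (f₂ t) t) (hV : ∀ t, HasDerivAt V (W t) t)
    (hg : ∀ t, ‖-f₂ t + Complex.I * W t * f t‖ ≤ μ ^ 2 * ‖f t‖)
    (hμ : 0 < μ) (hδ : 0 < δ) (hμδ : μ * δ < Real.pi / 2) {x : ℝ}
    (h0 : f x ≠ 0) (hmax : ∀ t, ‖f t‖ ≤ ‖f x‖) :
    ∃ c, ∫ t in (x - δ)..(x + δ), (V t - c) ^ 2 ≤ 36 * (μ * Real.tan (μ * δ)) := by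
  refine ⟨V x - (f₁ x / f x).im, ?_⟩
  have hs : ∀ {E : Type} [NormedAddCommGroup E] [NormedSpace ℝ E] {φ φ' : ℝ → E},
      (∀ t, HasDerivAt φ (φ' t) t) → ∀ t, HasDerivAt (fun s => φ (x + s)) (φ' (x + t)) t :=
    fun h t => (h (x + t)).comp_const_add x t
  have hr := integral_sq_sub_le_of_isMax (hs hf) (hs hf₁) (hs hV) (fun t => hg (x + t)) hμ hδ hμδ
    (by simpa using h0) (by simpa using fun t => hmax (x + t))
  have hl := integral_sq_sub_le_of_isMax (V := fun s => -V (x + -s)) (W := fun s => W (x + -s))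
    (hasDerivAt_comp_neg' (hs hf))
    (fun t => HasDerivAt.congr_deriv (hasDerivAt_comp_neg' (hs hf₁) t).neg (neg_neg _))
    (fun t => HasDerivAt.congr_deriv (hasDerivAt_comp_neg' (hs hV) t).neg (neg_neg _))
    (fun t => hg (x + -t)) hμ hδ hμδ (by simpa using h0) (by simpa using fun t => hmax (x + -t))
  have hVc : Continuous V := continuous_iff_continuousAt.2 fun t => (hV t).continuousAt
  have hint : ∀ a b, IntervalIntegrable (fun t => (V t - (V x - (f₁ x / f x).im)) ^ 2)
      MeasureTheory.volume a b := fun a b => Continuous.intervalIntegrable (by fun_prop) _ _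
  rw [← intervalIntegral.integral_add_adjacent_intervals (hint (x - δ) x) (hint x (x + δ))]
  have e1 : ∫ t in x..(x + δ), (V t - (V x - (f₁ x / f x).im)) ^ 2 =
      ∫ t in (0 : ℝ)..δ, (V (x + t) - (V (x + 0) - (f₁ (x + 0) / f (x + 0)).im)) ^ 2 := by
    rw [intervalIntegral.integral_comp_add_left
      (fun t => (V t - (V (x + 0) - (f₁ (x + 0) / f (x + 0)).im)) ^ 2) x]
    simp
  have e2 : ∫ t in (x - δ)..x, (V t - (V x - (f₁ x / f x).im)) ^ 2 =
      ∫ t in (0 : ℝ)..δ, (-V (x + -t) -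
        (-V (x + -0) - (-f₁ (x + -0) / f (x + -0)).im)) ^ 2 := by
    have := intervalIntegral.integral_comp_sub_left (a := 0) (b := δ)
      (fun t => (V t - (V x - (f₁ x / f x).im)) ^ 2) x
    rw [sub_zero] at this
    rw [← this]
    refine intervalIntegral.integral_congr fun t _ => ?_
    simp only [neg_zero, add_zero, neg_div, Complex.neg_im, ← sub_eq_add_neg]
    ring
  linarith

end Window

theorem LinearMap.IsSymmetric.exists_abs_eigenvalue_lt {E : Type*} [NormedAddCommGroup E]
    [InnerProductSpace ℝ E] [FiniteDimensional ℝ E] {A : E →ₗ[ℝ] E} (hA : A.IsSymmetric)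
    {c : ℝ} {x : E} (h : ‖A x‖ < c * ‖x‖) :
    ∃ (s : ℝ) (v : E), |s| < c ∧ ‖v‖ = 1 ∧ A v = s • v := by
  have hc : 0 < c := by
    by_contra! hc
    linarith [norm_nonneg (A x), mul_nonpos_of_nonpos_of_nonneg hc (norm_nonneg x)]
  by_contra! hcon
  have hev : ∀ i, c ≤ |hA.eigenvalues rfl i| := fun i => by
    by_contra! hi
    exact hcon _ _ hi ((hA.eigenvectorBasis rfl).orthonormal.1 i) (hA.apply_eigenvectorBasis rfl i)
  have h1 : (c * ‖x‖) ^ 2 ≤ ‖A x‖ ^ 2 := by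
    rw [mul_pow, ← (hA.eigenvectorBasis rfl).repr.norm_map x,
      ← (hA.eigenvectorBasis rfl).repr.norm_map (A x), EuclideanSpace.norm_sq_eq,
      EuclideanSpace.norm_sq_eq, Finset.mul_sum]
    refine Finset.sum_le_sum fun i _ => ?_
    rw [hA.eigenvectorBasis_apply_self_apply rfl, norm_mul, mul_pow]
    gcongr
    exact hev i
  exact absurd (abs_le_of_sq_le_sq' h1 (norm_nonneg _)).2 (not_le.2 h)

/-- A small value of a complex symmetric quadratic form's antilinear operator produces a
coneigenvector with small coneigenvalue. -/
theorem exists_coneigenvector_fintype {ι : Type*} [Fintype ι] (K : ι → ι → ℂ)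
    (hK : ∀ n m, K n m = K m n) {c : ℝ} {a : ι → ℂ}
    (h : √(∑ n, ‖∑ m, K n m * a m‖ ^ 2) < c * √(∑ n, ‖a n‖ ^ 2)) :
    ∃ (s : ℝ) (v : ι → ℂ), |s| < c ∧ ∑ n, ‖v n‖ ^ 2 = 1 ∧
      ∀ n, ∑ m, K n m * v m = s * star (v n) := by
  let A : EuclideanSpace ℂ ι →ₗ[ℝ] EuclideanSpace ℂ ι :=
    { toFun := fun v => WithLp.toLp 2 fun n => star (∑ m, K n m * v m)
      map_add' := fun v w => by
        ext n
        simp [mul_add, Finset.sum_add_distrib]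
      map_smul' := fun r v => by
        ext n
        simp [Finset.mul_sum, mul_left_comm] }
  have hAapp : ∀ v n, A v n = star (∑ m, K n m * v m) := fun v n => rfl
  have hA : A.IsSymmetric := fun v w => by
    simp only [PiLp.inner_apply, Complex.inner, hAapp]
    rw [← Complex.re_sum, ← Complex.re_sum]
    simp only [← starRingEnd_apply, Complex.conj_conj]
    rw [← Complex.conj_re (∑ i, _ * _)]
    congr 1
    simp only [map_sum, map_mul, Finset.sum_mul, Finset.mul_sum]
    rw [Finset.sum_comm]
    refine Finset.sum_congr rfl fun i _ => Finset.sum_congr rfl fun j _ => ?_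
    rw [hK]
    ring
  obtain ⟨s, v, hs, hv, hAv⟩ := hA.exists_abs_eigenvalue_lt (c := c) (x := WithLp.toLp 2 a) (by
    rw [EuclideanSpace.norm_eq, EuclideanSpace.norm_eq]
    simpa only [hAapp, norm_star] using h)
  refine ⟨s, v, hs, ?_, fun n => ?_⟩
  · rw [← EuclideanSpace.norm_sq_eq, hv, one_pow]
  · have := congrArg (fun w : EuclideanSpace ℂ ι => star (w n)) hAv
    simp only [hAapp, star_star] at this
    simp [this]

theorem exists_coneigenvector_finset {ι : Type*} (S : Finset ι) (K : ι → ι → ℂ)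
    (hK : ∀ n m, K n m = K m n) {c : ℝ} {a : ι → ℂ}
    (h : √(∑ n ∈ S, ‖∑ m ∈ S, K n m * a m‖ ^ 2) < c * √(∑ n ∈ S, ‖a n‖ ^ 2)) :
    ∃ (s : ℝ) (v : ι → ℂ), |s| < c ∧ (∀ n ∉ S, v n = 0) ∧ ∑ n ∈ S, ‖v n‖ ^ 2 = 1 ∧
      ∀ n ∈ S, ∑ m ∈ S, K n m * v m = s * star (v n) := by
  classical
  obtain ⟨s, v, hs, hv, hev⟩ := exists_coneigenvector_fintype (ι := S) (fun n m => K n m)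
    (fun n m => hK n m) (c := c) (a := fun n => a n) (by
      rw [← Finset.sum_coe_sort S, ← Finset.sum_coe_sort S] at h
      simpa only [← Finset.sum_coe_sort S] using h)
  have hext : ∀ n : S, (fun n => if hn : n ∈ S then v ⟨n, hn⟩ else 0) (n : ι) = v n := fun n => by
    simp
  refine ⟨s, fun n => if hn : n ∈ S then v ⟨n, hn⟩ else 0, hs, fun n hn => by simp [hn], ?_, ?_⟩
  · rw [← Finset.sum_coe_sort S, ← hv]
    exact Finset.sum_congr rfl fun n _ => by rw [hext]
  · intro n hn
    rw [← Finset.sum_coe_sort S]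
    have := hev ⟨n, hn⟩
    simp only [hext, hn, dif_pos]
    exact this

section Galerkin

open Filter Topology

variable {X : Type*} [NormedAddCommGroup X] [InnerProductSpace ℂ X]

theorem Orthonormal.norm_sq_sum_smul {ι : Type*} {e : ι → X} (he : Orthonormal ℂ e)
    (a : ι → ℂ) (S : Finset ι) : ‖∑ n ∈ S, a n • e n‖ ^ 2 = ∑ n ∈ S, ‖a n‖ ^ 2 := by
  have h : ((‖∑ n ∈ S, a n • e n‖ ^ 2 : ℝ) : ℂ) = ((∑ n ∈ S, ‖a n‖ ^ 2 : ℝ) : ℂ) := by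
    push_cast
    refine (inner_self_eq_norm_sq_to_K (𝕜 := ℂ) (∑ n ∈ S, a n • e n)).symm.trans ?_
    rw [he.inner_sum]
    exact Finset.sum_congr rfl fun n _ => Complex.conj_mul' (a n)
  exact_mod_cast h

theorem HilbertBasis.norm_sq_eq_tsum [CompleteSpace X] {ι : Type*} (b : HilbertBasis ι ℂ X)
    (x : X) :
    ‖x‖ ^ 2 = ∑' n, ‖inner ℂ (b n) x‖ ^ 2 := by
  rw [← b.repr.norm_map x]
  have := lp.norm_rpow_eq_tsum (p := 2) (by norm_num) (b.repr x)
  simpa [b.repr_apply_apply] using this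

/-- The Galerkin approximations of the coneigenvalue problem with matrix
`(n² δ_{n,m} + i ⟪bₙ, M bₘ⟫)_{n,m}`. -/
theorem exists_galerkin_coneigenvector (b : HilbertBasis ℤ ℂ X) (M : X →L[ℂ] X)
    (hM : ∀ n m, inner ℂ (b (-n)) (M (b m)) = inner ℂ (b (-m)) (M (b n))) {x y : X} {c : ℝ}
    (hy : ∀ n : ℤ, inner ℂ (b n) y =
      (n : ℂ) ^ 2 * inner ℂ (b n) x + Complex.I * inner ℂ (b n) (M x)) (N : ℕ)
    (h : ‖y‖ + ‖M‖ * ‖x - ∑ n ∈ Finset.Icc (-N : ℤ) N, inner ℂ (b n) x • b n‖ <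
      c * ‖∑ n ∈ Finset.Icc (-N : ℤ) N, inner ℂ (b n) x • b n‖) :
    ∃ (s : ℝ) (v : ℤ → ℂ), |s| < c ∧ (∀ n ∉ Finset.Icc (-N : ℤ) N, v n = 0) ∧
      ∑ n ∈ Finset.Icc (-N : ℤ) N, ‖v n‖ ^ 2 = 1 ∧ ∀ n ∈ Finset.Icc (-N : ℤ) N,
      (n : ℂ) ^ 2 * v n +
        Complex.I * inner ℂ (b n) (M (∑ m ∈ Finset.Icc (-N : ℤ) N, v m • b m)) =
          s * star (v (-n)) := by
  set S := Finset.Icc (-N : ℤ) N with hS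
  have hneg : ∀ n, n ∈ S → -n ∈ S := fun n hn => by
    simp only [hS, Finset.mem_Icc] at hn ⊢; omega
  let K : ℤ → ℤ → ℂ := fun n m =>
    (if m = -n then (n : ℂ) ^ 2 else 0) + Complex.I * inner ℂ (b (-n)) (M (b m))
  have hKsymm : ∀ n m, K n m = K m n := fun n m => by
    simp only [K]
    rw [hM]
    congr 1
    by_cases hnm : m = -n
    · subst hnm; simp
    · have : n ≠ -m := by omega
      simp [hnm, this]
  have hKsum : ∀ (a : ℤ → ℂ), ∀ n ∈ S, ∑ m ∈ S, K n m * a m =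
      (n : ℂ) ^ 2 * a (-n) + Complex.I * inner ℂ (b (-n)) (M (∑ m ∈ S, a m • b m)) :=
      fun a n hn => by
    simp only [K, add_mul, Finset.sum_add_distrib, ite_mul, zero_mul]
    rw [Finset.sum_ite_eq' S (-n), if_pos (hneg n hn)]
    congr 1
    simp only [map_sum, map_smul, inner_sum, inner_smul_right, Finset.mul_sum]
    exact Finset.sum_congr rfl fun m _ => by ring
  have hnorm : ∀ a : ℤ → ℂ, √(∑ n ∈ S, ‖a n‖ ^ 2) = ‖∑ n ∈ S, a n • b n‖ := fun a => by
    rw [Real.sqrt_eq_iff_eq_sq (by positivity) (norm_nonneg _),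
      b.orthonormal.norm_sq_sum_smul]
  set z := y - Complex.I • M (x - ∑ n ∈ S, inner ℂ (b n) x • b n) with hz
  have hzin : ∀ n ∈ S, ∑ m ∈ S, K n m * inner ℂ (b m) x = inner ℂ (b (-n)) z := fun n hn => by
    rw [hKsum (fun m => inner ℂ (b m) x) n hn, hz, inner_sub_right, hy, inner_smul_right, map_sub,
      inner_sub_right]
    push_cast
    ring
  obtain ⟨s, v, hs, hv0, hv1, hev⟩ := exists_coneigenvector_finset S K hKsymm (c := c)
    (a := fun n => inner ℂ (b n) x) (by
      rw [hnorm fun n => inner ℂ (b n) x]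
      refine lt_of_le_of_lt ?_ h
      have e : ∑ n ∈ S, ‖∑ m ∈ S, K n m * inner ℂ (b m) x‖ ^ 2 =
          ∑ n ∈ S, ‖inner ℂ (b n) z‖ ^ 2 := by
        refine Finset.sum_bij' (fun n _ => -n) (fun n _ => -n) hneg hneg (by simp) (by simp) ?_
        intro n hn
        rw [hzin n hn]
      rw [e]
      calc √(∑ n ∈ S, ‖inner ℂ (b n) z‖ ^ 2) ≤ √(‖z‖ ^ 2) :=
            Real.sqrt_le_sqrt (b.orthonormal.sum_inner_products_le z)
        _ = ‖z‖ := Real.sqrt_sq (norm_nonneg _)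
        _ ≤ ‖y‖ + ‖Complex.I • M (x - ∑ n ∈ S, inner ℂ (b n) x • b n)‖ := norm_sub_le _ _
        _ ≤ _ := by
          rw [norm_smul, Complex.norm_I, one_mul]
          gcongr
          exact M.le_opNorm _)
  refine ⟨s, v, hs, hv0, hv1, fun n hn => ?_⟩
  have := hev (-n) (hneg n hn)
  rw [hKsum v (-n) (hneg n hn)] at this
  simpa using this

theorem exists_coneigenvector_of_norm_lt [CompleteSpace X] (b : HilbertBasis ℤ ℂ X) (M : X →L[ℂ] X)
    (hM : ∀ n m, inner ℂ (b (-n)) (M (b m)) = inner ℂ (b (-m)) (M (b n))) {x y : X} {c : ℝ}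
    (hy : ∀ n : ℤ, inner ℂ (b n) y =
      (n : ℂ) ^ 2 * inner ℂ (b n) x + Complex.I * inner ℂ (b n) (M x))
    (h : ‖y‖ < c * ‖x‖) :
    ∃ (s : ℝ) (z : X), |s| ≤ c ∧ ‖z‖ = 1 ∧ ∀ n : ℤ,
      (n : ℂ) ^ 2 * inner ℂ (b n) z + Complex.I * inner ℂ (b n) (M z) =
        s * star (inner ℂ (b (-n)) z) := by
  let S : ℕ → Finset ℤ := fun N => Finset.Icc (-N : ℤ) N
  have hSmem : ∀ n : ℤ, ∀ᶠ N in atTop, n ∈ S N := fun n => by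
    filter_upwards [eventually_ge_atTop n.natAbs] with N hN
    simp only [S, Finset.mem_Icc]; omega
  have hStop : Tendsto S atTop atTop := by
    refine tendsto_atTop_finset_of_monotone (fun N N' hNN' => ?_) fun n => (hSmem n).exists
    exact Finset.Icc_subset_Icc (by simpa using hNN') (by simpa using hNN')
  have hP : Tendsto (fun N => ∑ n ∈ S N, inner ℂ (b n) x • b n) atTop (𝓝 x) := by
    have := (b.hasSum_repr x).comp hStop
    simpa only [b.repr_apply_apply, Function.comp_def] using this
  have hev : ∀ᶠ N in atTop, ‖y‖ + ‖M‖ * ‖x - ∑ n ∈ S N, inner ℂ (b n) x • b n‖ <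
      c * ‖∑ n ∈ S N, inner ℂ (b n) x • b n‖ := by
    have h1 : Tendsto (fun N => ‖y‖ + ‖M‖ * ‖x - ∑ n ∈ S N, inner ℂ (b n) x • b n‖) atTop
        (𝓝 (‖y‖ + ‖M‖ * ‖x - x‖)) :=
      ((hP.const_sub x).norm.const_mul _).const_add _
    rw [sub_self, norm_zero, mul_zero, add_zero] at h1
    exact h1.eventually_lt (hP.norm.const_mul c) h
  obtain ⟨N₀, hN₀⟩ := eventually_atTop.1 hev
  choose s v hs hv0 hv1 heq using fun N : ℕ =>
    exists_galerkin_coneigenvector b M hM hy (N₀ + N) (hN₀ (N₀ + N) (by omega))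
  change ∀ N, ∀ n ∉ S (N₀ + N), v N n = 0 at hv0
  change ∀ N, ∑ n ∈ S (N₀ + N), ‖v N n‖ ^ 2 = 1 at hv1
  change ∀ N, ∀ n ∈ S (N₀ + N), (n : ℂ) ^ 2 * v N n +
    Complex.I * inner ℂ (b n) (M (∑ m ∈ S (N₀ + N), v N m • b m)) = s N * star (v N (-n)) at heq
  set Z : ℕ → X := fun N => ∑ m ∈ S (N₀ + N), v N m • b m with hZ
  have hZn : ∀ N n, inner ℂ (b n) (Z N) = v N n := fun N n => by
    by_cases hn : n ∈ S (N₀ + N)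
    · exact b.orthonormal.inner_right_sum _ hn
    · rw [hv0 N n hn, hZ, inner_sum]
      refine Finset.sum_eq_zero fun m hm => ?_
      rw [inner_smul_right, b.orthonormal.2 (by rintro rfl; exact hn hm), mul_zero]
  have hZ1 : ∀ N, ‖Z N‖ = 1 := fun N => by
    have : ‖Z N‖ ^ 2 = 1 := by rw [hZ, b.orthonormal.norm_sq_sum_smul, hv1]
    exact (pow_eq_one_iff_of_nonneg (norm_nonneg _) two_ne_zero).1 this
  have hc : 0 < c := (abs_nonneg _).trans_lt (hs 0)
  have hle : ∀ n (w : X), ‖inner ℂ (b n) w‖ ≤ ‖w‖ := fun n w => by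
    simpa [b.orthonormal.1 n] using norm_inner_le_norm (𝕜 := ℂ) (b n) w
  set B : ℤ → ℝ := fun n => (c + ‖M‖ + 1) / ((n : ℝ) ^ 2 + 1) with hB
  have hv1' : ∀ N n, ‖v N n‖ ≤ 1 := fun N n => by
    rw [← hZn, ← hZ1 N]; exact hle _ _
  have hvB : ∀ N n, ‖v N n‖ ≤ B n := fun N n => by
    rw [hB, le_div_iff₀ (by positivity)]
    by_cases hn : n ∈ S (N₀ + N)
    · have h1 : (n : ℂ) ^ 2 * v N n =
          s N * star (v N (-n)) - Complex.I * inner ℂ (b n) (M (Z N)) := by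
        rw [← heq N n hn]; ring
      have h2 : (n : ℝ) ^ 2 * ‖v N n‖ ≤ c + ‖M‖ := by
        calc (n : ℝ) ^ 2 * ‖v N n‖ = ‖(n : ℂ) ^ 2 * v N n‖ := by simp
          _ ≤ ‖s N * star (v N (-n))‖ + ‖Complex.I * inner ℂ (b n) (M (Z N))‖ := by
            rw [h1]; exact norm_sub_le _ _
          _ = |s N| * ‖v N (-n)‖ + ‖inner ℂ (b n) (M (Z N))‖ := by simp
          _ ≤ c * 1 + ‖M‖ * 1 := by
            have := M.le_opNorm (Z N)
            rw [hZ1] at this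
            gcongr
            · exact (hs N).le
            · exact hv1' _ _
            · exact (hle _ _).trans this
          _ = c + ‖M‖ := by ring
      nlinarith [hv1' N n]
    · rw [hv0 N n hn]; simp; positivity
  have hcpt : IsCompact (Set.Icc (-c) c ×ˢ Set.univ.pi fun n => Metric.closedBall (0 : ℂ) (B n)) :=
    isCompact_Icc.prod (isCompact_univ_pi fun n => isCompact_closedBall _ _)
  obtain ⟨⟨σ, w⟩, hσw, φ, hφ, hlim⟩ := hcpt.isSeqCompact (x := fun N => (s N, v N)) (fun N =>
    ⟨abs_le.1 (hs N).le, fun n _ => by simpa using hvB N n⟩)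
  have hσ : Tendsto (fun k => s (φ k)) atTop (𝓝 σ) := (continuous_fst.tendsto _).comp hlim
  have hw : ∀ n, Tendsto (fun k => v (φ k) n) atTop (𝓝 (w n)) := fun n =>
    (((continuous_apply n).comp continuous_snd).tendsto _).comp hlim
  have hwB : ∀ n, ‖w n‖ ≤ B n := fun n => by simpa using hσw.2 n (Set.mem_univ n)
  have hBnn : ∀ n, 0 ≤ B n := fun n => (norm_nonneg _).trans (hwB n)
  have hBle : ∀ n, B n ≤ c + ‖M‖ + 1 := fun n => by
    rw [hB]
    exact div_le_self (by positivity) (by nlinarith [sq_nonneg (n : ℝ)])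
  have hBsum : Summable B := by
    have h1 : Summable fun n : ℤ => (c + ‖M‖ + 1) * (1 / (n : ℝ) ^ 2) :=
      (Real.summable_one_div_int_pow.2 (by norm_num)).mul_left _
    refine h1.of_norm_bounded_eventually ?_
    filter_upwards [(Set.finite_singleton (0 : ℤ)).compl_mem_cofinite] with n hn
    have hn : n ≠ 0 := by simpa using hn
    have : 0 < (n : ℝ) ^ 2 := by positivity
    rw [Real.norm_of_nonneg (hBnn n), hB, mul_one_div]
    exact div_le_div_of_nonneg_left (by positivity) this (by linarith)
  have hB2sum : Summable fun n => (2 * B n) ^ 2 := by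
    refine (hBsum.mul_left (4 * (c + ‖M‖ + 1))).of_nonneg_of_le (fun n => sq_nonneg _) fun n => ?_
    nlinarith [hBnn n, hBle n]
  have hwmem : Memℓp w 2 := by
    refine memℓp_gen (hB2sum.of_nonneg_of_le (fun n => by positivity) fun n => ?_)
    simp only [ENNReal.toReal_ofNat, Real.rpow_two]
    exact pow_le_pow_left₀ (norm_nonneg _) (by linarith [hwB n, hBnn n]) 2
  set z : X := b.repr.symm ⟨w, hwmem⟩ with hz
  have hzn : ∀ n, inner ℂ (b n) z = w n := fun n => by
    rw [← b.repr_apply_apply, hz, LinearIsometryEquiv.apply_symm_apply]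
  have hZz : Tendsto (fun k => Z (φ k)) atTop (𝓝 z) := by
    rw [tendsto_iff_norm_sub_tendsto_zero]
    have h1 : Tendsto (fun k => ‖Z (φ k) - z‖ ^ 2) atTop (𝓝 0) := by
      have h2 : ∀ k, ‖Z (φ k) - z‖ ^ 2 = ∑' n, ‖v (φ k) n - w n‖ ^ 2 := fun k => by
        rw [b.norm_sq_eq_tsum]
        simp only [inner_sub_right, hZn, hzn]
      simp only [h2]
      have h3 := tendsto_tsum_of_dominated_convergence (𝓕 := atTop)
        (f := fun k n => ‖v (φ k) n - w n‖ ^ 2) (g := fun _ => (0 : ℝ)) hB2sum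
        (fun n => by simpa using ((hw n).sub_const (w n)).norm.pow 2)
        (Eventually.of_forall fun k n => by
          rw [Real.norm_of_nonneg (by positivity)]
          refine pow_le_pow_left₀ (norm_nonneg _) ?_ 2
          linarith [norm_sub_le (v (φ k) n) (w n), hvB (φ k) n, hwB n])
      simpa using h3
    have h4 := h1.sqrt
    simpa only [Real.sqrt_sq (norm_nonneg _), Real.sqrt_zero] using h4
  refine ⟨σ, z, abs_le.2 hσw.1, ?_, fun n => ?_⟩
  · refine tendsto_nhds_unique hZz.norm ?_
    simp only [hZ1]
    exact tendsto_const_nhds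
  · have hl : Tendsto
        (fun k => (n : ℂ) ^ 2 * v (φ k) n + Complex.I * inner ℂ (b n) (M (Z (φ k)))) atTop
        (𝓝 ((n : ℂ) ^ 2 * inner ℂ (b n) z + Complex.I * inner ℂ (b n) (M z))) := by
      rw [hzn]
      refine ((hw n).const_mul _).add (Tendsto.const_mul _ ?_)
      exact tendsto_const_nhds.inner ((M.continuous.tendsto z).comp hZz)
    have hr : Tendsto (fun k => (s (φ k) : ℂ) * star (v (φ k) (-n))) atTop
        (𝓝 (σ * star (inner ℂ (b (-n)) z))) := by
      rw [hzn]
      exact ((Complex.continuous_ofReal.tendsto _).comp hσ).mul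
        ((continuous_star.tendsto _).comp (hw (-n)))
    refine tendsto_nhds_unique_of_eventuallyEq hl hr ?_
    have := hφ.tendsto_atTop.eventually (tendsto_add_atTop_nat N₀ |>.eventually (hSmem n))
    filter_upwards [this] with k hk
    exact heq (φ k) n (by rwa [add_comm])

end Galerkin

section Circle

open AddCircle MeasureTheory

theorem AddCircle.continuous_coe_comp {T : ℝ} (g : C(AddCircle T, ℂ)) :
    Continuous fun t : ℝ => g (t : AddCircle T) :=
  g.continuous.comp (AddCircle.continuous_mk' T)

variable {T : ℝ} [hT : Fact (0 < T)]

theorem ContinuousMap.integrable_haarAddCircle (g : C(AddCircle T, ℂ)) :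
    Integrable g haarAddCircle := by
  have := (g.continuous.continuousOn (s := Set.univ)).integrableOn_compact (μ := haarAddCircle)
    isCompact_univ
  rwa [integrableOn_univ] at this

theorem fourierCoeff_sub (F G : C(AddCircle T, ℂ)) (n : ℤ) :
    fourierCoeff (F - G : C(AddCircle T, ℂ)) n = fourierCoeff F n - fourierCoeff G n := by
  have h : ((F - G : C(AddCircle T, ℂ)) : AddCircle T → ℂ) = F + (-1 : ℂ) • (G : AddCircle T → ℂ) := by
    ext x; simp [sub_eq_add_neg]
  rw [h, fourierCoeff.add F.integrable_haarAddCircle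
    (G.integrable_haarAddCircle.smul (-1 : ℂ))]
  rw [Pi.add_apply, fourierCoeff.const_smul, neg_one_smul, sub_eq_add_neg]

theorem fourierCoeff_of_hasDerivAt {G G' : C(AddCircle T, ℂ)}
    (hG : ∀ t : ℝ, HasDerivAt (fun r : ℝ => G r) (G' t) t) (n : ℤ) :
    fourierCoeff G' n = 2 * Real.pi * Complex.I * n / T * fourierCoeff G n := by
  have hd : ∀ t : ℝ, HasDerivAt (fun r : ℝ => fourier (-n) (r : AddCircle T) * G r)
      (fourier (-n) (t : AddCircle T) * G' t -
        2 * Real.pi * Complex.I * n / T * (fourier (-n) (t : AddCircle T) * G t)) t := fun t => by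
    refine ((hasDerivAt_fourier_neg T n t).mul (hG t)).congr_deriv ?_
    ring
  have hc : Continuous fun t : ℝ => fourier (-n) (t : AddCircle T) * G t :=
    continuous_coe_comp (fourier (-n) * G)
  have hc' : Continuous fun t : ℝ => fourier (-n) (t : AddCircle T) * G' t :=
    continuous_coe_comp (fourier (-n) * G')
  have hint := intervalIntegral.integral_eq_sub_of_hasDerivAt (a := 0) (b := 0 + T)
    (fun t _ => hd t) ((hc'.sub (hc.const_mul _)).intervalIntegrable _ _)
  rw [intervalIntegral.integral_sub (hc'.intervalIntegrable _ _)
    ((hc.const_mul _).intervalIntegrable _ _), intervalIntegral.integral_const_mul,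
    AddCircle.coe_add, AddCircle.coe_period, add_zero, sub_self, sub_eq_zero] at hint
  rw [fourierCoeff_eq_intervalIntegral _ n 0, fourierCoeff_eq_intervalIntegral _ n 0]
  simp only [smul_eq_mul]
  rw [hint]
  simp only [Complex.real_smul]
  ring

theorem exists_hasDerivAt_of_fourierCoeff_zero {g : C(AddCircle T, ℂ)}
    (hg : fourierCoeff g 0 = 0) :
    ∃ G : C(AddCircle T, ℂ), ∀ t : ℝ, HasDerivAt (fun r : ℝ => G r) (g t) t := by
  have hgc := continuous_coe_comp g
  have hd : ∀ t : ℝ, HasDerivAt (fun r : ℝ => ∫ y in (0 : ℝ)..r, g y) (g t) t := fun t =>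
    intervalIntegral.integral_hasDerivAt_right (hgc.intervalIntegrable _ _)
      (hgc.stronglyMeasurableAtFilter _ _) hgc.continuousAt
  have hp : Function.Periodic (fun r : ℝ => ∫ y in (0 : ℝ)..r, g y) T := fun r => by
    have h0 : ∫ y in r..(r + T), g y = 0 := by
      rw [fourierCoeff_eq_intervalIntegral _ 0 r] at hg
      simpa [hT.out.ne'] using hg
    change ∫ y in (0 : ℝ)..(r + T), g y = ∫ y in (0 : ℝ)..r, g y
    rw [← intervalIntegral.integral_add_adjacent_intervals
      (hgc.intervalIntegrable 0 r) (hgc.intervalIntegrable r (r + T)), h0, add_zero]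
  refine ⟨⟨hp.lift, ?_⟩, fun t => ?_⟩
  · refine continuous_coinduced_dom.2 ?_
    exact continuous_iff_continuousAt.2 fun t => (hd t).continuousAt
  · exact hd t

theorem eq_fourierCoeff_zero_of_fourierCoeff_eq_zero {F : C(AddCircle T, ℂ)}
    (hF : ∀ n ≠ 0, fourierCoeff F n = 0) (x : AddCircle T) : F x = fourierCoeff F 0 := by
  have hs : Summable (fourierCoeff F) :=
    summable_of_ne_finset_zero (s := {0}) fun n hn => hF n (by simpa using hn)
  have h1 := has_pointwise_sum_fourier_series_of_summable hs x
  have h2 : HasSum (fun n => fourierCoeff F n • fourier n x) (fourierCoeff F 0 • fourier 0 x) :=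
    hasSum_single 0 fun n hn => by rw [hF n hn, zero_smul]
  rw [h1.unique h2, fourier_zero, smul_eq_mul, mul_one]

theorem hasDerivAt_of_fourierCoeff {F g : C(AddCircle T, ℂ)}
    (h : ∀ n, fourierCoeff g n = 2 * Real.pi * Complex.I * n / T * fourierCoeff F n) (t : ℝ) :
    HasDerivAt (fun r : ℝ => F r) (g t) t := by
  obtain ⟨G, hG⟩ := exists_hasDerivAt_of_fourierCoeff_zero (g := g) (by simpa using h 0)
  have hFG : ∀ n ≠ 0, fourierCoeff (F - G : C(AddCircle T, ℂ)) n = 0 := fun n hn => by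
    have h1 := fourierCoeff_of_hasDerivAt hG n
    rw [h n] at h1
    have h2 : (2 * Real.pi * Complex.I * n / T : ℂ) ≠ 0 := by
      have := hT.out.ne'
      simp [Real.pi_ne_zero, hn, this]
    rw [fourierCoeff_sub, mul_left_cancel₀ h2 h1, sub_self]
  have hconst := eq_fourierCoeff_zero_of_fourierCoeff_eq_zero hFG
  have hF : (fun r : ℝ => F r) =
      fun r : ℝ => G r + fourierCoeff (F - G : C(AddCircle T, ℂ)) 0 := by
    ext r
    rw [← hconst r]
    simp
  rw [hF]
  exact (hG t).add_const _

theorem exists_hasDerivAt_hasDerivAt_of_fourierCoeff {F h : C(AddCircle T, ℂ)}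
    (hF : ∀ n, fourierCoeff h n = (2 * Real.pi * Complex.I * n / T) ^ 2 * fourierCoeff F n) :
    ∃ F₁ : C(AddCircle T, ℂ), (∀ t : ℝ, HasDerivAt (fun r : ℝ => F r) (F₁ t) t) ∧
      ∀ t : ℝ, HasDerivAt (fun r : ℝ => F₁ r) (h t) t := by
  obtain ⟨H, hH⟩ := exists_hasDerivAt_of_fourierCoeff_zero (g := h) (by simpa using hF 0)
  set K : C(AddCircle T, ℂ) := ContinuousMap.const _ (fourierCoeff H 0) with hK
  have hKn : ∀ n, fourierCoeff K n = if n = 0 then fourierCoeff H 0 else 0 := fun n => by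
    have h1 : (K : AddCircle T → ℂ) = fourierCoeff H 0 • (fourier 0 : AddCircle T → ℂ) := by
      ext x; simp [hK]
    rw [h1, fourierCoeff.const_smul, fourierCoeff_fourier]
    simp [Pi.single_apply]
  have hH' : ∀ t : ℝ, HasDerivAt (fun r : ℝ => (H - K) r) (h t) t := fun t => by
    simpa [hK] using (hH t).sub_const (fourierCoeff H 0)
  refine ⟨H - K, hasDerivAt_of_fourierCoeff fun n => ?_, hH'⟩
  by_cases hn : n = 0
  · subst hn
    rw [fourierCoeff_sub, hKn]
    simp
  · have h2 : (2 * Real.pi * Complex.I * n / T : ℂ) ≠ 0 := by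
      have := hT.out.ne'
      simp [Real.pi_ne_zero, hn, this]
    have h1 := fourierCoeff_of_hasDerivAt hH' n
    rw [hF n, pow_two, mul_assoc] at h1
    exact (mul_left_cancel₀ h2 h1).symm

end Circle

section Coneigenfunction

open AddCircle MeasureTheory

theorem fourierCoeff_add' {T : ℝ} [Fact (0 < T)] (F G : C(AddCircle T, ℂ)) (n : ℤ) :
    fourierCoeff (F + G : C(AddCircle T, ℂ)) n = fourierCoeff F n + fourierCoeff G n := by
  rw [ContinuousMap.coe_add, fourierCoeff.add F.integrable_haarAddCircle G.integrable_haarAddCircle,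
    Pi.add_apply]

theorem fourierCoeff_smul' {T : ℝ} [Fact (0 < T)] (a : ℂ) (F : C(AddCircle T, ℂ)) (n : ℤ) :
    fourierCoeff (a • F : C(AddCircle T, ℂ)) n = a * fourierCoeff F n := by
  rw [ContinuousMap.coe_smul, fourierCoeff.const_smul, smul_eq_mul]

theorem fourierCoeff_star {T : ℝ} [Fact (0 < T)] (F : C(AddCircle T, ℂ)) (n : ℤ) :
    fourierCoeff (star F : C(AddCircle T, ℂ)) n = star (fourierCoeff F (-n)) := by
  rw [fourierCoeff, fourierCoeff, Complex.star_def, ← integral_conj]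
  refine integral_congr_ae (.of_forall fun t => ?_)
  simp

theorem exists_continuousLinearMap_toLp_mul {T : ℝ} [Fact (0 < T)] (w : C(AddCircle T, ℂ)) :
    ∃ M : Lp ℂ 2 (haarAddCircle (T := T)) →L[ℂ] Lp ℂ 2 (haarAddCircle (T := T)),
      ∀ g : C(AddCircle T, ℂ), M (ContinuousMap.toLp 2 haarAddCircle ℂ g) =
        ContinuousMap.toLp 2 haarAddCircle ℂ (w * g) := by
  refine ⟨(ContinuousLinearMap.mul ℂ ℂ).holderL haarAddCircle ⊤ 2 2
    (ContinuousMap.toLp ⊤ haarAddCircle ℂ w), fun g => ?_⟩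
  rw [ContinuousLinearMap.holderL_apply_apply]
  apply Lp.ext
  filter_upwards [(ContinuousLinearMap.mul ℂ ℂ).coeFn_holder (r := 2)
      (ContinuousMap.toLp ⊤ haarAddCircle ℂ w) (ContinuousMap.toLp 2 haarAddCircle ℂ g),
    ContinuousMap.coeFn_toLp (p := ⊤) (𝕜 := ℂ) haarAddCircle w,
    ContinuousMap.coeFn_toLp (p := 2) (𝕜 := ℂ) haarAddCircle g,
    ContinuousMap.coeFn_toLp (p := 2) (𝕜 := ℂ) haarAddCircle (w * g)] with t h1 h2 h3 h4
  rw [h1, h2, h3, h4]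
  simp

theorem exists_coneigenfunction_circle [Fact (0 < 2 * Real.pi)]
    {w f f₁ f₂ : C(AddCircle (2 * Real.pi), ℂ)}
    (hf : ∀ t : ℝ, HasDerivAt (fun r : ℝ => f r) (f₁ t) t)
    (hf₁ : ∀ t : ℝ, HasDerivAt (fun r : ℝ => f₁ r) (f₂ t) t) {c : ℝ}
    (h : ‖ContinuousMap.toLp 2 haarAddCircle ℂ ((-1 : ℂ) • f₂ + Complex.I • (w * f))‖ <
      c * ‖ContinuousMap.toLp 2 haarAddCircle ℂ f‖) :
    ∃ (s : ℝ) (F F₁ F₂ : C(AddCircle (2 * Real.pi), ℂ)), |s| ≤ c ∧ F ≠ 0 ∧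
      (∀ t : ℝ, HasDerivAt (fun r : ℝ => F r) (F₁ t) t) ∧
      (∀ t : ℝ, HasDerivAt (fun r : ℝ => F₁ r) (F₂ t) t) ∧
      ∀ x, -F₂ x + Complex.I * w x * F x = s * star (F x) := by
  obtain ⟨M, hMw⟩ := exists_continuousLinearMap_toLp_mul w
  set b := fourierBasis (T := 2 * Real.pi) with hb
  have hbn : ∀ n, b n = ContinuousMap.toLp 2 haarAddCircle ℂ (fourier n) := fun n => by
    rw [hb, coe_fourierBasis]
  have hinner : ∀ n (g : C(AddCircle (2 * Real.pi), ℂ)),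
      inner ℂ (b n) (ContinuousMap.toLp 2 haarAddCircle ℂ g) = fourierCoeff g n := fun n g => by
    rw [← HilbertBasis.repr_apply_apply, fourierBasis_repr, fourierCoeff_toLp]
  have hscale : ∀ n : ℤ, (2 * Real.pi * Complex.I * n / (2 * Real.pi : ℝ) : ℂ) =
      Complex.I * n := fun n => by
    have : (Real.pi : ℂ) ≠ 0 := by simp [Real.pi_ne_zero]
    push_cast
    field_simp
  have hf₂ : ∀ n, fourierCoeff f₂ n = -(n : ℂ) ^ 2 * fourierCoeff f n := fun n => by
    rw [fourierCoeff_of_hasDerivAt hf₁, fourierCoeff_of_hasDerivAt hf, hscale]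
    linear_combination (n : ℂ) ^ 2 * fourierCoeff f n * Complex.I_sq
  have hMsymm : ∀ n m, inner ℂ (b (-n)) (M (b m)) = inner ℂ (b (-m)) (M (b n)) := fun n m => by
    rw [hbn m, hbn n, hMw, hMw, hinner, hinner, fourierCoeff, fourierCoeff]
    refine integral_congr_ae (.of_forall fun t => ?_)
    simp only [neg_neg, ContinuousMap.mul_apply, smul_eq_mul]
    ring
  obtain ⟨s, z, hs, hz1, hz⟩ := exists_coneigenvector_of_norm_lt b M hMsymm
    (x := ContinuousMap.toLp 2 haarAddCircle ℂ f)
    (y := ContinuousMap.toLp 2 haarAddCircle ℂ ((-1 : ℂ) • f₂ + Complex.I • (w * f)))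
    (fun n => by
      rw [hMw, hinner, hinner, hinner, fourierCoeff_add', fourierCoeff_smul', fourierCoeff_smul',
        hf₂]
      ring) h
  have hle : ∀ n (v : Lp ℂ 2 (haarAddCircle (T := 2 * Real.pi))), ‖inner ℂ (b n) v‖ ≤ ‖v‖ :=
    fun n v => by
      simpa [b.orthonormal.1 n] using norm_inner_le_norm (𝕜 := ℂ) (b n) v
  have hsum : Summable fun n : ℤ => ‖inner ℂ (b n) z‖ := by
    have h1 : Summable fun n : ℤ => (|s| + ‖M z‖) * (1 / (n : ℝ) ^ 2) :=
      (Real.summable_one_div_int_pow.2 (by norm_num)).mul_left _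
    refine h1.of_norm_bounded_eventually ?_
    filter_upwards [(Set.finite_singleton (0 : ℤ)).compl_mem_cofinite] with n hn
    have hn : n ≠ 0 := by simpa using hn
    have hn2 : 0 < (n : ℝ) ^ 2 := by positivity
    rw [norm_norm, mul_one_div, le_div_iff₀ hn2, mul_comm]
    calc (n : ℝ) ^ 2 * ‖inner ℂ (b n) z‖ = ‖(n : ℂ) ^ 2 * inner ℂ (b n) z‖ := by simp
      _ = ‖s * star (inner ℂ (b (-n)) z) - Complex.I * inner ℂ (b n) (M z)‖ := by
        rw [← hz n]; congr 1; ring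
      _ ≤ ‖s * star (inner ℂ (b (-n)) z)‖ + ‖Complex.I * inner ℂ (b n) (M z)‖ := norm_sub_le _ _
      _ = |s| * ‖inner ℂ (b (-n)) z‖ + ‖inner ℂ (b n) (M z)‖ := by
        simp only [norm_mul, norm_star, Complex.norm_real, Real.norm_eq_abs, Complex.norm_I, one_mul]
      _ ≤ |s| * 1 + ‖M z‖ := by
        gcongr
        · rw [← hz1]; exact hle _ _
        · exact hle _ _
      _ = |s| + ‖M z‖ := by ring
  have hsumC : Summable fun n : ℤ =>
      (inner ℂ (b n) z • fourier n : C(AddCircle (2 * Real.pi), ℂ)) := by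
    refine .of_norm ?_
    simpa [norm_smul, fourier_norm] using hsum
  set F := ∑' n : ℤ, (inner ℂ (b n) z • fourier n : C(AddCircle (2 * Real.pi), ℂ)) with hF
  have hFz : ContinuousMap.toLp 2 haarAddCircle ℂ F = z := by
    have h1 := hsumC.hasSum.mapL (ContinuousMap.toLp 2 haarAddCircle ℂ)
    have h2 := b.hasSum_repr z
    refine h1.unique ?_
    simpa only [map_smul, hbn, HilbertBasis.repr_apply_apply] using h2
  have hFn : ∀ n, inner ℂ (b n) z = fourierCoeff F n := fun n => by rw [← hFz, hinner]
  set F₂ : C(AddCircle (2 * Real.pi), ℂ) := Complex.I • (w * F) + (-s : ℂ) • star F with hF₂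
  obtain ⟨F₁, hd, hd₁⟩ := exists_hasDerivAt_hasDerivAt_of_fourierCoeff (F := F) (h := F₂)
    (fun n => by
      have := hz n
      rw [← hFz, hMw, hinner, hinner, hinner] at this
      rw [hscale, hF₂, fourierCoeff_add', fourierCoeff_smul', fourierCoeff_smul',
        fourierCoeff_star]
      linear_combination this - (n : ℂ) ^ 2 * fourierCoeff F n * Complex.I_sq)
  refine ⟨s, F, F₁, F₂, hs, ?_, hd, hd₁, fun x => ?_⟩
  · rintro h0
    rw [h0, map_zero] at hFz
    rw [← hFz, norm_zero] at hz1
    exact zero_ne_one hz1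
  · simp only [hF₂, ContinuousMap.add_apply, ContinuousMap.smul_apply, ContinuousMap.mul_apply,
      ContinuousMap.star_apply, smul_eq_mul]
    ring

end Coneigenfunction

section Resolvent

open AddCircle MeasureTheory

theorem l2norm_const_mul {a : ℝ} (ha : 0 ≤ a) (f : ℝ → ℂ) :
    l2norm (fun y => (a : ℂ) * f y) = a * l2norm f := by
  simp only [l2norm, norm_mul, mul_pow, intervalIntegral.integral_const_mul, Complex.norm_real,
    Real.norm_of_nonneg ha]
  rw [Real.sqrt_mul (sq_nonneg a), Real.sqrt_sq ha]

theorem l2norm_coe_eq [Fact (0 < 2 * Real.pi)] (g : C(AddCircle (2 * Real.pi), ℂ)) :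
    l2norm (fun t => g t) =
      √(2 * Real.pi) * ‖ContinuousMap.toLp (E := ℂ) 2 haarAddCircle ℂ g‖ := by
  have hp : (0 : ℝ) < 2 * Real.pi := Real.two_pi_pos
  have h1 : ‖ContinuousMap.toLp (E := ℂ) 2 haarAddCircle ℂ g‖ ^ 2 =
      (2 * Real.pi)⁻¹ * ∫ t in (0 : ℝ)..(2 * Real.pi), ‖g t‖ ^ 2 := by
    have h2 := tsum_sq_fourierCoeff (ContinuousMap.toLp (E := ℂ) 2 haarAddCircle ℂ g)
    have h3 := (fourierBasis (T := 2 * Real.pi)).norm_sq_eq_tsum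
      (ContinuousMap.toLp (E := ℂ) 2 haarAddCircle ℂ g)
    simp only [← HilbertBasis.repr_apply_apply, fourierBasis_repr] at h3
    rw [h3, h2]
    have h4 : ∫ t, ‖ContinuousMap.toLp (E := ℂ) 2 haarAddCircle ℂ g t‖ ^ 2 ∂haarAddCircle =
        ∫ t, ‖g t‖ ^ 2 ∂(haarAddCircle (T := 2 * Real.pi)) := by
      refine integral_congr_ae ?_
      filter_upwards [ContinuousMap.coeFn_toLp (p := 2) (𝕜 := ℂ) haarAddCircle g] with t ht
      rw [ht]
    rw [h4, integral_haarAddCircle, ← AddCircle.intervalIntegral_preimage _ 0, zero_add,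
      smul_eq_mul]
  rw [l2norm, ← Real.sqrt_sq (norm_nonneg (ContinuousMap.toLp (E := ℂ) 2 haarAddCircle ℂ g)), h1,
    ← Real.sqrt_mul hp.le, mul_inv_cancel_left₀ hp.ne']

theorem Function.Periodic.of_hasDerivAt {f f₁ : ℝ → ℂ} {T : ℝ} (hp : Function.Periodic f T)
    (hf : ∀ t, HasDerivAt f (f₁ t) t) : Function.Periodic f₁ T := fun t => by
  have h1 := (hf (t + T)).comp_add_const t T
  rw [show (fun r => f (r + T)) = f from funext hp] at h1
  exact h1.unique (hf t)

theorem exists_coneigenfunction {W : ℝ → ℝ} (hW : Continuous W)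
    (hWp : Function.Periodic W (2 * Real.pi)) {f f₁ f₂ : ℝ → ℂ}
    (hf : ∀ t, HasDerivAt f (f₁ t) t) (hf₁ : ∀ t, HasDerivAt f₁ (f₂ t) t) (hf₂ : Continuous f₂)
    (hfp : Function.Periodic f (2 * Real.pi)) {c : ℝ}
    (h : l2norm (fun t => -f₂ t + Complex.I * W t * f t) < c * l2norm f) :
    ∃ (s : ℝ) (F F₁ F₂ : ℝ → ℂ), |s| ≤ c ∧ (∃ t, F t ≠ 0) ∧ Function.Periodic F (2 * Real.pi) ∧
      (∀ t, HasDerivAt F (F₁ t) t) ∧ (∀ t, HasDerivAt F₁ (F₂ t) t) ∧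
      ∀ t, -F₂ t + Complex.I * W t * F t = s * star (F t) := by
  have : Fact (0 < 2 * Real.pi) := ⟨Real.two_pi_pos⟩
  have hf₁p := hfp.of_hasDerivAt hf
  have hf₂p := hf₁p.of_hasDerivAt hf₁
  have hwp : Function.Periodic (fun t => (W t : ℂ)) (2 * Real.pi) := fun t => by simp [hWp t]
  let lift : ∀ g : ℝ → ℂ, Continuous g → Function.Periodic g (2 * Real.pi) →
      C(AddCircle (2 * Real.pi), ℂ) := fun g hg hp => ⟨hp.lift, continuous_coinduced_dom.2 hg⟩
  let w' := lift _ (Complex.continuous_ofReal.comp hW) hwp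
  let f' := lift f (continuous_iff_continuousAt.2 fun t => (hf t).continuousAt) hfp
  let f₁' := lift f₁ (continuous_iff_continuousAt.2 fun t => (hf₁ t).continuousAt) hf₁p
  let f₂' := lift f₂ hf₂ hf₂p
  have e1 := l2norm_coe_eq ((-1 : ℂ) • f₂' + Complex.I • (w' * f'))
  have e2 := l2norm_coe_eq f'
  have e3 : (fun t : ℝ => ((-1 : ℂ) • f₂' + Complex.I • (w' * f')) t) =
      fun t => -f₂ t + Complex.I * W t * f t := by
    ext t
    change (-1 : ℂ) * f₂ t + Complex.I * (W t * f t) = _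
    ring
  rw [e3] at e1
  change l2norm f = _ at e2
  rw [e1, e2, mul_left_comm] at h
  obtain ⟨s, F, F₁, F₂, hs, hF0, hd, hd₁, heq⟩ :=
    exists_coneigenfunction_circle (w := w') (f := f') (f₁ := f₁') (f₂ := f₂') hf hf₁
      (lt_of_mul_lt_mul_left h (Real.sqrt_nonneg _))
  refine ⟨s, fun t => F t, fun t => F₁ t, fun t => F₂ t, hs, ?_, fun t => ?_, hd, hd₁,
    fun t => heq t⟩
  · by_contra! hcon
    refine hF0 (ContinuousMap.ext fun x => ?_)
    induction x using QuotientAddGroup.induction_on with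
    | H t => exact hcon t
  · simp

theorem exists_forall_norm_le_of_periodic {F : ℝ → ℂ} {T : ℝ} (hT : 0 < T) (hF : Continuous F)
    (hp : Function.Periodic F T) : ∃ x, ∀ t, ‖F t‖ ≤ ‖F x‖ := by
  obtain ⟨x, -, hx⟩ := isCompact_Icc.exists_isMaxOn (Set.nonempty_Icc.2 hT.le)
    (hF.norm.continuousOn (s := Set.Icc 0 T))
  refine ⟨x, fun t => ?_⟩
  obtain ⟨y, hy, hty⟩ := hp.exists_mem_Ico₀ hT t
  rw [hty]
  exact hx (Set.Ico_subset_Icc_self hy)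

theorem lt_of_lt_phiInv {C x : ℝ} (hC : 0 ≤ C) (hx : 0 < x) (h : x < phiInv C) :
    x < Real.pi / 2 ∧ 36 * x * Real.tan x < C := by
  obtain ⟨y, ⟨⟨-, hy⟩, hyC⟩, hxy⟩ := exists_lt_of_lt_csSup
    (⟨0, ⟨le_rfl, by positivity⟩, by simpa using hC⟩ :
      {x : ℝ | x ∈ Set.Ico 0 (Real.pi / 2) ∧ 36 * x * Real.tan x ≤ C}.Nonempty) h
  have hx0 : 0 < Real.tan x := Real.tan_pos_of_pos_of_lt_pi_div_two hx (hxy.trans hy)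
  have ht : Real.tan x < Real.tan y := Real.tan_lt_tan_of_nonneg_of_lt_pi_div_two hx.le hy hxy
  refine ⟨hxy.trans hy, lt_of_lt_of_le ?_ hyC⟩
  have : 36 * x < 36 * y := by linarith
  exact mul_lt_mul'' this ht (by positivity) hx0.le

theorem omega1_le (δ : ℝ) (hδ : 0 ≤ δ) (ψ : ℝ → ℝ) (x c₁ c₂ : ℝ) :
    omega1 δ ψ ≤ ∫ y in (x - δ)..(x + δ), (ψ y - c₁ - c₂ * y) ^ 2 := by
  refine csInf_le ⟨0, ?_⟩ ⟨x, c₁, c₂, rfl⟩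
  rintro r ⟨x', a, b, rfl⟩
  exact intervalIntegral.integral_nonneg (by linarith) fun y _ => sq_nonneg _

end Resolvent

/-- The lower bound on `ω₁` at scale `δ` prevents the spectral bound `μ²` from being too small. -/
theorem mul_le_of_coneigenfunction {ψ u : ℝ → ℝ} (hψ : ∀ y, HasDerivAt ψ (u y) y) {ν κ lam : ℝ}
    (hν : 0 < ν) (hκ : κ ≠ 0) {F F₁ F₂ : ℝ → ℂ} {s μ δ : ℝ} (hs : |s| ≤ μ ^ 2)
    (hF0 : ∃ t, F t ≠ 0) (hFp : Function.Periodic F (2 * Real.pi))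
    (hF : ∀ t, HasDerivAt F (F₁ t) t) (hF₁ : ∀ t, HasDerivAt F₁ (F₂ t) t)
    (heq : ∀ t, -F₂ t + Complex.I * ((κ * u t - lam) / ν : ℝ) * F t = s * star (F t))
    (hμ : 0 < μ) (hδ : 0 < δ) (hμδ : μ * δ < Real.pi / 2) :
    (κ / ν) ^ 2 * omega1 δ ψ ≤ 36 * (μ * Real.tan (μ * δ)) := by
  obtain ⟨x, hx⟩ := exists_forall_norm_le_of_periodic Real.two_pi_pos
    (continuous_iff_continuousAt.2 fun t => (hF t).continuousAt) hFp
  obtain ⟨t₀, ht₀⟩ := hF0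
  have hx0 : F x ≠ 0 := norm_pos_iff.1 ((norm_pos_iff.2 ht₀).trans_le (hx t₀))
  have hV : ∀ t, HasDerivAt (fun t => (κ * ψ t - lam * t) / ν) ((κ * u t - lam) / ν) t :=
    fun t => by
      simpa using (((hψ t).const_mul κ).sub ((hasDerivAt_id t).const_mul lam)).div_const ν
  obtain ⟨c, hc⟩ := exists_integral_sq_sub_le hF hF₁ hV (μ := μ) (fun t => by
    rw [heq, norm_mul, norm_star, Complex.norm_real, Real.norm_eq_abs]
    gcongr) hμ hδ hμδ hx0 hx
  refine le_trans ?_ hc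
  have h1 := mul_le_mul_of_nonneg_left (omega1_le δ hδ.le ψ x (c * ν / κ) (lam / κ))
    (sq_nonneg (κ / ν))
  rw [← intervalIntegral.integral_const_mul] at h1
  refine h1.trans (le_of_eq ?_)
  congr 1
  ext t
  have := hν.ne'
  field_simp
  ring

/-- Resolvent estimate behind enhanced dissipation: if
`ω₁(δ, u) ≥ C₁ δ^{2α+3}` for `δ ∈ (0,1)`, then for `ν > 0` and `0 ≠ k ∈ ℤ`
with `ν|k|⁻¹ ≤ 1/2`, the operator `R_{k,ν} = iku - ν∂_y²` satisfies
`‖(R_{k,ν} - iλ)f‖ ≥ ε ν^{α/(α+2)} |k|^{2/(α+2)} ‖f‖` with `ε = (φ⁻¹(C₁))²`. -/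
theorem stmt_12 (α C₁ : ℝ) (hα : 0 < α) (hC₁ : 0 < C₁)
    (u : ℝ → ℝ) (hu : Continuous u) (huper : Function.Periodic u (2 * Real.pi))
    (ψ : ℝ → ℝ) (hψ : ∀ y, HasDerivAt ψ (u y) y)
    (hlow : ∀ δ : ℝ, δ ∈ Set.Ioo (0 : ℝ) 1 → C₁ * δ ^ (2 * α + 3) ≤ omega1 δ ψ)
    (ν : ℝ) (hν : 0 < ν) (k : ℤ) (hk : k ≠ 0) (hνk : ν / |(k : ℝ)| ≤ 1 / 2) :
    ∀ f : ℝ → ℂ, ContDiff ℝ 2 f → Function.Periodic f (2 * Real.pi) → ∀ lam : ℝ,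
      (phiInv C₁) ^ 2 * ν ^ (α / (α + 2)) * |(k : ℝ)| ^ (2 / (α + 2)) * l2norm f ≤
        l2norm fun y => -(ν : ℂ) * deriv (deriv f) y + Complex.I * (k : ℂ) * (u y : ℂ) * f y
          - Complex.I * (lam : ℂ) * f y := by
  intro f hf hfp lam
  by_contra! hcon
  set κ : ℝ := (k : ℝ) with hκ
  have hκ0 : κ ≠ 0 := by simpa [hκ] using hk
  have hκpos : 0 < |κ| := abs_pos.2 hκ0
  have hα2 : 0 < α + 2 := by linarith
  set q : ℝ := ν / |κ| with hq
  have hq0 : 0 < q := div_pos hν hκpos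
  set δ : ℝ := q ^ (1 / (α + 2)) with hδdef
  have hδ0 : 0 < δ := Real.rpow_pos_of_pos hq0 _
  have hδ1 : δ < 1 := Real.rpow_lt_one hq0.le (by linarith) (by positivity)
  have hδpow : δ ^ (2 * α + 3) * δ = q ^ 2 := by
    rw [← Real.rpow_add_one hδ0.ne', hδdef, ← Real.rpow_mul hq0.le, ← Real.rpow_natCast]
    congr 1
    push_cast
    field_simp
    ring
  have hrate : ν ^ (α / (α + 2)) * |κ| ^ (2 / (α + 2)) = ν / δ ^ 2 := by
    have h1 : δ ^ 2 = ν ^ (2 / (α + 2)) / |κ| ^ (2 / (α + 2)) := by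
      rw [← Real.div_rpow hν.le hκpos.le, hδdef, ← Real.rpow_natCast, ← Real.rpow_mul hq0.le]
      congr 1
      push_cast
      ring
    have h2 : ν ^ (α / (α + 2)) * ν ^ (2 / (α + 2)) = ν := by
      rw [← Real.rpow_add hν, ← add_div, div_self hα2.ne', Real.rpow_one]
    have h3 := Real.rpow_pos_of_pos hκpos (2 / (α + 2))
    have h4 := Real.rpow_pos_of_pos hν (2 / (α + 2))
    rw [h1, eq_div_iff (by positivity)]
    field_simp
    exact h2
  set f₁ := deriv f with hf₁def
  have hd : ∀ t, HasDerivAt f (f₁ t) t := fun t =>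
    (hf.differentiable (by norm_num) t).hasDerivAt
  have hfd : ContDiff ℝ 1 f₁ := by
    have h1 : ContDiff ℝ (1 + 1) f := by simpa [one_add_one_eq_two] using hf
    exact (contDiff_succ_iff_deriv.1 h1).2.2
  have hd₁ : ∀ t, HasDerivAt f₁ (deriv f₁ t) t := fun t =>
    (hfd.differentiable one_ne_zero t).hasDerivAt
  have hd₂ : Continuous (deriv f₁) := hfd.continuous_deriv le_rfl
  set W : ℝ → ℝ := fun t => (κ * u t - lam) / ν with hW
  have hWc : Continuous W := ((continuous_const.mul hu).sub continuous_const).div_const ν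
  have hWp : Function.Periodic W (2 * Real.pi) := fun t => by simp only [hW, huper t]
  set g : ℝ → ℂ := fun t => -deriv f₁ t + Complex.I * W t * f t with hg
  have hRg : (fun y => -(ν : ℂ) * deriv f₁ y + Complex.I * (k : ℂ) * (u y : ℂ) * f y
      - Complex.I * (lam : ℂ) * f y) = fun y => (ν : ℂ) * g y := by
    ext y
    have : (ν : ℂ) ≠ 0 := by exact_mod_cast hν.ne'
    simp only [hg, hW, hκ]
    push_cast
    field_simp
    ring
  rw [hRg, l2norm_const_mul hν.le, mul_assoc ((phiInv C₁) ^ 2), hrate] at hcon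
  have hgf : l2norm g < (phiInv C₁ / δ) ^ 2 * l2norm f := by
    refine lt_of_mul_lt_mul_left (hcon.trans_le (le_of_eq ?_)) hν.le
    ring
  have hg0 : 0 ≤ l2norm g := Real.sqrt_nonneg _
  have hf0 : 0 < l2norm f := by
    refine lt_of_le_of_ne (Real.sqrt_nonneg _) fun h => ?_
    rw [← h, mul_zero] at hgf
    exact absurd hgf (not_lt.2 hg0)
  have hphi : 0 ≤ phiInv C₁ := Real.sSup_nonneg fun x hx => hx.1.1
  obtain ⟨m, hm, hm'⟩ := exists_between ((div_lt_iff₀ hf0).2 hgf)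
  have hm0 : 0 < m := (div_nonneg hg0 hf0.le).trans_lt hm
  set μ := √m with hμ
  have hμ0 : 0 < μ := Real.sqrt_pos.2 hm0
  have hμ2 : μ ^ 2 = m := Real.sq_sqrt hm0.le
  have hμδ : μ * δ < phiInv C₁ := by
    rw [← lt_div_iff₀ hδ0, hμ]
    exact (Real.sqrt_lt_sqrt hm0.le hm').trans_eq (Real.sqrt_sq (by positivity))
  obtain ⟨hlt, hC⟩ := lt_of_lt_phiInv hC₁.le (mul_pos hμ0 hδ0) hμδ
  obtain ⟨s, F, F₁, F₂, hs, hF0, hFp, hF, hF₁, heq⟩ :=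
    exists_coneigenfunction hWc hWp hd hd₁ hd₂ hfp ((div_lt_iff₀ hf0).1 hm)
  have key := mul_le_of_coneigenfunction hψ hν hκ0 (hs.trans hμ2.ge) hF0 hFp hF hF₁ heq hμ0 hδ0 hlt
  have hom := mul_le_mul_of_nonneg_left (hlow δ ⟨hδ0, hδ1⟩) (sq_nonneg (κ / ν))
  have hCδ : C₁ = (κ / ν) ^ 2 * (C₁ * δ ^ (2 * α + 3)) * δ := by
    have h1 : (κ / ν) ^ 2 * q ^ 2 = 1 := by
      rw [hq, div_pow, div_pow, sq_abs]
      have := hν.ne'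
      field_simp
    rw [← hδpow] at h1
    linear_combination -C₁ * h1
  have h2 := mul_le_mul_of_nonneg_right (hom.trans key) hδ0.le
  rw [← hCδ] at h2
  linarith
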